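/- Let G be a graph and let t = φ_r(G). If every induced minimal b-t-atom of G is feasible in G, then φ(G) = φ_r(G). -/

import Mathlib

noncomputable section

open Function

/-- A proper coloring of `G` with colors in `Fin k`. -/
def IsProperColoring {V : Type} (G : SimpleGraph V) {k : ℕ} (c : V → Fin k) : Prop :=
  ∀ u v : V, G.Adj u v → c u ≠ c v

/-- A b-`k`-coloring: a surjective proper coloring in which every color class
contains a b-vertex. -/
def IsBColoring {V : Type} (G : SimpleGraph V) {k : ℕ} (c : V → Fin k) : Prop :=
  Function.Surjective c ∧ IsProperColoring G c ∧
    ∀ i : Fin k, ∃ v : V, c v = i ∧ ∀ j : Fin k, j ≠ i → ∃ u : V, G.Adj v u ∧ c u = j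

def HasBColoring {V : Type} (G : SimpleGraph V) (k : ℕ) : Prop :=
  ∃ c : V → Fin k, IsBColoring G c

/-- The b-chromatic number `φ(G)`. -/
def bChromatic {V : Type} [Fintype V] (G : SimpleGraph V) : ℕ :=
  sSup {k | HasBColoring G k}

/-- The b-relaxed number `φ_r(G)`: the maximum of `φ(H)` over induced subgraphs `H`. -/
def bRelaxed {V : Type} [Fintype V] (G : SimpleGraph V) : ℕ :=
  sSup {k | ∃ s : Finset V, bChromatic (G.induce (↑s : Set V)) = k}

/-- A partial Grundy `k`-coloring: a surjective proper coloring in which every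
color class contains a Grundy vertex. -/
def IsPartialGrundyColoring {V : Type} (G : SimpleGraph V) {k : ℕ} (c : V → Fin k) : Prop :=
  Function.Surjective c ∧ IsProperColoring G c ∧
    ∀ i : Fin k, ∃ v : V, c v = i ∧ ∀ j : Fin k, j < i → ∃ u : V, G.Adj v u ∧ c u = j

/-- The partial Grundy number `∂Γ(G)`. -/
def partialGrundy {V : Type} [Fintype V] (G : SimpleGraph V) : ℕ :=
  sSup {k | ∃ c : V → Fin k, IsPartialGrundyColoring G c}

/-- A pG-`t`-atom structure on a graph `A`. -/
def IsPGAtom {V : Type} (A : SimpleGraph V) (t : ℕ) : Prop :=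
  ∃ (D : Fin t → Finset V) (c : Fin t → V),
    (∀ v : V, ∃! i : Fin t, v ∈ D i) ∧
    (∀ i : Fin t, c i ∈ D i) ∧
    (∀ i : Fin t, ∀ u ∈ D i, ∀ v ∈ D i, ¬ A.Adj u v) ∧
    (∀ i : Fin t, (D i).card ≤ t - (i : ℕ)) ∧
    (∀ i j : Fin t, j < i → ∃ v ∈ D j, A.Adj (c i) v)

/-- A minimal pG-`t`-atom: no proper induced subgraph is a pG-`t`-atom. -/
def IsMinPGAtom {V : Type} [Fintype V] (A : SimpleGraph V) (t : ℕ) : Prop :=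
  IsPGAtom A t ∧
    ∀ s : Finset V, s ≠ Finset.univ → ¬ IsPGAtom (A.induce (↑s : Set V)) t

/-- A b-`t`-atom structure on a graph `A`. -/
def IsBAtom {V : Type} (A : SimpleGraph V) (t : ℕ) : Prop :=
  ∃ (D : Fin t → Finset V) (c : Fin t → V),
    (∀ v : V, ∃! i : Fin t, v ∈ D i) ∧
    (∀ i : Fin t, c i ∈ D i) ∧
    (∀ i : Fin t, ∀ u ∈ D i, ∀ v ∈ D i, ¬ A.Adj u v) ∧
    (∀ i : Fin t, (D i).card ≤ t) ∧
    (∀ i j : Fin t, i ≠ j → ∃ v ∈ D j, A.Adj (c i) v)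

/-- A minimal b-`t`-atom: no proper induced subgraph is a b-`t`-atom. -/
def IsMinBAtom {V : Type} [Fintype V] (A : SimpleGraph V) (t : ℕ) : Prop :=
  IsBAtom A t ∧
    ∀ s : Finset V, s ≠ Finset.univ → ¬ IsBAtom (A.induce (↑s : Set V)) t

/-- `V(A) ∪ N(A)` for the induced subgraph of `G` on `s`. -/
def closedNbhdSet {V : Type} (G : SimpleGraph V) (s : Set V) : Set V :=
  s ∪ {v : V | v ∉ s ∧ ∃ u ∈ s, G.Adj u v}

/-- The induced subgraph of `G` on `s` is feasible (as a b-`t`-atom) in `G`: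
some b-`t`-coloring of it extends to a proper coloring of the induced subgraph
on `V(A) ∪ N(A)` using only the `t` colors. -/
def IsFeasibleIn {V : Type} (G : SimpleGraph V) (s : Finset V) (t : ℕ) : Prop :=
  ∃ c : V → Fin t,
    IsBColoring (G.induce (↑s : Set V)) (fun v => c v.1) ∧
    ∀ u v : V, u ∈ closedNbhdSet G (↑s : Set V) → v ∈ closedNbhdSet G (↑s : Set V) →
      G.Adj u v → c u ≠ c v

/-- A b-`t`-trap vertex: an induced b-`t`-atom avoiding `v`, not feasible in `G`
but feasible in `G - v`. -/
def IsVertexBTrap {V : Type} [Fintype V] [DecidableEq V] (G : SimpleGraph V) (v : V)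
    (t : ℕ) : Prop :=
  ∃ s : Finset V, v ∉ s ∧ IsBAtom (G.induce (↑s : Set V)) t ∧ ¬ IsFeasibleIn G s t ∧
    IsFeasibleIn (G.induce {u : V | u ≠ v}) (s.subtype (fun u => u ≠ v)) t

/-- A b-`t`-trap edge: an induced b-`t`-atom, not feasible in `G`
but feasible in `G - e`. -/
def IsEdgeBTrap {V : Type} (G : SimpleGraph V) (e : Sym2 V) (t : ℕ) : Prop :=
  ∃ s : Finset V, IsBAtom (G.induce (↑s : Set V)) t ∧ ¬ IsFeasibleIn G s t ∧
    IsFeasibleIn (G.deleteEdges {e}) s t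

/-- The chromatic number as a natural number (least `k` admitting a surjective
proper `k`-coloring). -/
def chromaticNum {V : Type} [Fintype V] (G : SimpleGraph V) : ℕ :=
  sInf {k | ∃ c : V → Fin k, Function.Surjective c ∧ IsProperColoring G c}

/-- `G` is b-χ-`k`-bounded: `φ(G') - χ(G') ≤ k` for every induced subgraph `G'`. -/
def IsBChiBounded {V : Type} [Fintype V] (G : SimpleGraph V) (k : ℕ) : Prop :=
  ∀ s : Finset V,
    bChromatic (G.induce (↑s : Set V)) - chromaticNum (G.induce (↑s : Set V)) ≤ k

/-- A χ-`k`-unbounded b-atom: a b-`t`-atom (for some positive `t`) with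
`φ(G) - χ(G) > k`. -/
def IsChiUnboundedBAtom {V : Type} [Fintype V] (A : SimpleGraph V) (k : ℕ) : Prop :=
  k < bChromatic A - chromaticNum A ∧ ∃ t : ℕ, 1 ≤ t ∧ IsBAtom A t

/-- A minimal χ-`k`-unbounded b-atom. -/
def IsMinChiUnboundedBAtom {V : Type} [Fintype V] (A : SimpleGraph V) (k : ℕ) : Prop :=
  IsChiUnboundedBAtom A k ∧
    ∀ s : Finset V, s ≠ Finset.univ → ¬ IsChiUnboundedBAtom (A.induce (↑s : Set V)) k

end

open Classical in
/-- Nested induced subgraphs are induced subgraphs. -/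
def induceInduceIso {V : Type} (G : SimpleGraph V) (s : Finset V) (r : Finset (↑s : Set V)) :
    (G.induce (↑s : Set V)).induce (↑r : Set (↑s : Set V)) ≃g
      G.induce (↑(r.image Subtype.val) : Set V) where
  toFun x := ⟨x.1.1, Finset.mem_coe.2 (Finset.mem_image_of_mem _ (Finset.mem_coe.1 x.2))⟩
  invFun y := ⟨⟨y.1, by
      obtain ⟨a, -, ha⟩ := Finset.mem_image.1 (Finset.mem_coe.1 y.2)
      exact ha ▸ a.2⟩, by
      obtain ⟨a, har, ha⟩ := Finset.mem_image.1 (Finset.mem_coe.1 y.2)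
      have : (⟨y.1, ha ▸ a.2⟩ : (↑s : Set V)) = a := Subtype.ext ha.symm
      exact Finset.mem_coe.2 ((congrArg (· ∈ r) this).mpr har)⟩
  left_inv _ := rfl
  right_inv _ := rfl
  map_rel_iff' := Iff.rfl

lemma IsBAtom.of_iso {V W : Type} {A : SimpleGraph V} {B : SimpleGraph W} {t : ℕ}
    (e : A ≃g B) (hA : IsBAtom A t) : IsBAtom B t := by
  obtain ⟨D, c, hD, hc, hind, hcard, hadj⟩ := hA
  have mem (i : Fin t) (w : W) :
      w ∈ (D i).map e.toEquiv.toEmbedding ↔ e.symm w ∈ D i := by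
    rw [Finset.mem_map_equiv]
    rfl
  refine ⟨fun i => (D i).map e.toEquiv.toEmbedding, fun i => e (c i), fun w => ?_, fun i => ?_,
    fun i u hu v hv huv => ?_, fun i => ?_, fun i j hij => ?_⟩
  · simpa only [mem] using hD (e.symm w)
  · simpa only [mem, RelIso.symm_apply_apply] using hc i
  · exact hind i _ ((mem i u).1 hu) _ ((mem i v).1 hv) (e.symm.map_rel_iff.2 huv)
  · simpa using hcard i
  · obtain ⟨v, hv, hcv⟩ := hadj i j hij
    exact ⟨e v, by simpa only [mem, RelIso.symm_apply_apply] using hv, e.map_rel_iff.2 hcv⟩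

open Classical in
lemma HasBColoring.exists_isBAtom {V : Type} {G : SimpleGraph V} {t : ℕ}
    (h : HasBColoring G t) : ∃ s : Finset V, IsBAtom (G.induce (↑s : Set V)) t := by
  obtain ⟨c, -, hproper, hb⟩ := h
  choose w hw hadj using hb
  have hn (i j : Fin t) : ∃ u, c u = j ∧ (j ≠ i → G.Adj (w i) u) ∧ (j = i → u = w i) := by
    by_cases hji : j = i
    · exact ⟨w i, hji ▸ hw i, fun h => absurd hji h, fun _ => rfl⟩
    · obtain ⟨u, hu, hcu⟩ := hadj i j hji
      exact ⟨u, hcu, fun _ => hu, fun h => absurd h hji⟩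
  choose n hnc hnadj hnself using hn
  let s : Finset V := Finset.univ.image fun p : Fin t × Fin t => n p.1 p.2
  have hns (i j : Fin t) : n i j ∈ (↑s : Set V) :=
    Finset.mem_coe.2 (Finset.mem_image.2 ⟨(i, j), Finset.mem_univ _, rfl⟩)
  let m (i j : Fin t) : (↑s : Set V) := ⟨n i j, hns i j⟩
  refine ⟨s, fun j => Finset.univ.image fun i => m i j, fun i => m i i, ?_, ?_, ?_, ?_, ?_⟩
  · rintro ⟨v, hv⟩
    obtain ⟨⟨i, j⟩, -, rfl⟩ := Finset.mem_image.1 (Finset.mem_coe.1 hv)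
    refine ⟨j, Finset.mem_image.2 ⟨i, Finset.mem_univ _, rfl⟩, fun k hk => ?_⟩
    obtain ⟨l, -, hl⟩ := Finset.mem_image.1 hk
    have : n l k = n i j := congrArg Subtype.val hl
    rw [← hnc l k, this, hnc i j]
  · exact fun i => Finset.mem_image.2 ⟨i, Finset.mem_univ _, rfl⟩
  · intro i u hu v hv huv
    obtain ⟨k, -, rfl⟩ := Finset.mem_image.1 hu
    obtain ⟨l, -, rfl⟩ := Finset.mem_image.1 hv
    exact hproper _ _ huv ((hnc k i).trans (hnc l i).symm)
  · exact fun i => Finset.card_image_le.trans (by simp)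
  · intro i j hij
    refine ⟨m i j, Finset.mem_image.2 ⟨i, Finset.mem_univ _, rfl⟩, ?_⟩
    change G.Adj (n i i) (n i j)
    rw [hnself i i rfl]
    exact hnadj i j hij.symm

lemma HasBColoring.le_card {V : Type} [Fintype V] {G : SimpleGraph V} {k : ℕ}
    (h : HasBColoring G k) : k ≤ Fintype.card V := by
  obtain ⟨c, hc, -⟩ := h
  simpa using Fintype.card_le_of_surjective c hc

lemma HasBColoring.le_bChromatic {V : Type} [Fintype V] {G : SimpleGraph V} {k : ℕ}
    (h : HasBColoring G k) : k ≤ bChromatic G :=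
  le_csSup ⟨Fintype.card V, fun _ hk => HasBColoring.le_card hk⟩ h

lemma hasBColoring_bChromatic {V : Type} [Fintype V] {G : SimpleGraph V}
    (h : 0 < bChromatic G) : HasBColoring G (bChromatic G) := by
  have hne : {k | HasBColoring G k}.Nonempty := by
    by_contra hne
    rw [Set.not_nonempty_iff_eq_empty] at hne
    simp [bChromatic, hne] at h
  exact Nat.sSup_mem hne ⟨Fintype.card V, fun _ hk => HasBColoring.le_card hk⟩

lemma bddAbove_bChromatic_induce {V : Type} [Fintype V] (G : SimpleGraph V) :
    BddAbove {k | ∃ s : Finset V, bChromatic (G.induce (↑s : Set V)) = k} :=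
  (Set.finite_range fun s : Finset V => bChromatic (G.induce (↑s : Set V))).bddAbove

lemma HasBColoring.le_bRelaxed {V : Type} [Fintype V] {G : SimpleGraph V} {s : Finset V} {k : ℕ}
    (h : HasBColoring (G.induce (↑s : Set V)) k) : k ≤ bRelaxed G :=
  h.le_bChromatic.trans (le_csSup (bddAbove_bChromatic_induce G) ⟨s, rfl⟩)

lemma exists_hasBColoring_bRelaxed {V : Type} [Fintype V] {G : SimpleGraph V}
    (h : 0 < bRelaxed G) :
    ∃ s : Finset V, HasBColoring (G.induce (↑s : Set V)) (bRelaxed G) := by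
  obtain ⟨s, hs⟩ : ∃ s : Finset V, bChromatic (G.induce (↑s : Set V)) = bRelaxed G :=
    Nat.sSup_mem (s := {k | ∃ s : Finset V, bChromatic (G.induce (↑s : Set V)) = k})
      ⟨_, ∅, rfl⟩ (bddAbove_bChromatic_induce G)
  rw [← hs] at h ⊢
  exact ⟨s, hasBColoring_bChromatic h⟩

lemma bChromatic_le_bRelaxed {V : Type} [Fintype V] (G : SimpleGraph V) :
    bChromatic G ≤ bRelaxed G := by
  refine csSup_le' ?_
  rintro k ⟨c, hsurj, hproper, hb⟩
  have mem (v : V) : v ∈ (↑(Finset.univ : Finset V) : Set V) := by simp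
  refine HasBColoring.le_bRelaxed (s := Finset.univ) ⟨fun v => c v.1, fun i => ?_,
    fun u v huv => hproper _ _ huv, fun i => ?_⟩
  · obtain ⟨v, hv⟩ := hsurj i
    exact ⟨⟨v, mem v⟩, hv⟩
  · obtain ⟨v, hv, hadj⟩ := hb i
    refine ⟨⟨v, mem v⟩, hv, fun j hj => ?_⟩
    obtain ⟨u, hu, huj⟩ := hadj j hj
    exact ⟨⟨u, mem u⟩, hu, huj⟩

open Classical in
lemma exists_isMinBAtom_of_isBAtom {V : Type} [Fintype V] {G : SimpleGraph V} {t : ℕ}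
    {s₀ : Finset V} (h : IsBAtom (G.induce (↑s₀ : Set V)) t) :
    ∃ s : Finset V, IsMinBAtom (G.induce (↑s : Set V)) t := by
  obtain ⟨s, hs, hmin⟩ := (measure Finset.card).wf.has_min
    {s : Finset V | IsBAtom (G.induce (↑s : Set V)) t} ⟨s₀, h⟩
  refine ⟨s, hs, fun r hr hatom => hmin (r.image Subtype.val)
    (hatom.of_iso (induceInduceIso G s r)) ?_⟩
  change (r.image Subtype.val).card < s.card
  have : r.card < Fintype.card (↑s : Set V) := Finset.card_lt_univ_of_notMem
    (x := (not_forall.1 fun h => hr (Finset.eq_univ_iff_forall.2 h)).choose)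
    (not_forall.1 fun h => hr (Finset.eq_univ_iff_forall.2 h)).choose_spec
  exact Finset.card_image_le.trans_lt (by simpa using this)

open Classical in
/-- If no induced subgraph has a b-coloring with `t + 1` colors, a proper `t`-coloring of `S`
yields one of `S ∪ {v}` with the same values off the neighborhood of `v`. -/
lemma exists_proper_extension {V : Type} [Fintype V] {G : SimpleGraph V} {t : ℕ}
    (hG : ∀ s : Finset V, ¬ HasBColoring (G.induce (↑s : Set V)) (t + 1))
    {S : Set V} {d : V → Fin t} (hd : ∀ x ∈ S, ∀ y ∈ S, G.Adj x y → d x ≠ d y)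
    {v : V} (hv : v ∉ S) :
    ∃ d' : V → Fin t, (∀ x, x ≠ v → ¬ G.Adj v x → d' x = d x) ∧
      ∀ x ∈ insert v S, ∀ y ∈ insert v S, G.Adj x y → d' x ≠ d' y := by
  by_cases hi : ∃ i : Fin t, ∀ x ∈ S, G.Adj v x → d x = i →
      ∃ j, j ≠ i ∧ ∀ y ∈ S, G.Adj x y → d y ≠ j
  · obtain ⟨i, hi⟩ := hi
    have hf (x : V) : ∃ j : Fin t, x ∈ S → G.Adj v x → d x = i →
        j ≠ i ∧ ∀ y ∈ S, G.Adj x y → d y ≠ j := by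
      by_cases hx : x ∈ S ∧ G.Adj v x ∧ d x = i
      · obtain ⟨j, hj⟩ := hi x hx.1 hx.2.1 hx.2.2
        exact ⟨j, fun _ _ _ => hj⟩
      · exact ⟨i, fun h1 h2 h3 => absurd ⟨h1, h2, h3⟩ hx⟩
    choose f hf using hf
    refine ⟨fun x => if x = v then i else if G.Adj v x ∧ d x = i then f x else d x,
      fun x hxv hx => by simp [hxv, hx], ?_⟩
    have hself : ∀ x ∈ S, G.Adj v x →
        (if G.Adj v x ∧ d x = i then f x else d x) ≠ i := by
      intro x hx hvx
      by_cases hxi : d x = i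
      · simpa [hvx, hxi] using (hf x hx hvx hxi).1
      · simp [hxi]
    rintro x (rfl | hx) y (rfl | hy) hxy
    · exact absurd hxy (G.loopless.irrefl _)
    · have : y ≠ x := fun h => hv (h ▸ hy)
      simpa only [if_true, this, if_false] using (hself y hy hxy).symm
    · have : x ≠ y := fun h => hv (h ▸ hx)
      simpa only [if_true, this, if_false] using hself x hx hxy.symm
    · have hxv : x ≠ v := fun h => hv (h ▸ hx)
      have hyv : y ≠ v := fun h => hv (h ▸ hy)
      have hdxy := hd x hx y hy hxy
      simp only [hxv, hyv, if_false]
      by_cases h1 : G.Adj v x ∧ d x = i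
      · have h2 : ¬ (G.Adj v y ∧ d y = i) := fun h2 => hdxy (h1.2.trans h2.2.symm)
        rw [if_pos h1, if_neg h2]
        exact ((hf x hx h1.1 h1.2).2 y hy hxy).symm
      · rw [if_neg h1]
        by_cases h2 : G.Adj v y ∧ d y = i
        · rw [if_pos h2]
          exact (hf y hy h2.1 h2.2).2 x hx hxy.symm
        · rwa [if_neg h2]
  · push Not at hi
    choose b hbS hvb hdb hb using hi
    have mem (x : V) : x ∈ (↑(insert v S).toFinset : Set V) ↔ x = v ∨ x ∈ S := by simp
    have hbv (i : Fin t) : b i ≠ v := fun h => hv (h ▸ hbS i)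
    let e : V → Fin (t + 1) := fun x => if x = v then Fin.last t else (d x).castSucc
    have hev : e v = Fin.last t := if_pos rfl
    have heS {x : V} (hx : x ∈ S) : e x = (d x).castSucc :=
      if_neg fun h : x = v => hv (h ▸ hx)
    have hbvert : ∀ i : Fin (t + 1), ∃ x : (↑(insert v S).toFinset : Set V), e x.1 = i ∧
        ∀ j, j ≠ i → ∃ u : (↑(insert v S).toFinset : Set V), G.Adj x.1 u.1 ∧ e u.1 = j := by
      intro i
      induction i using Fin.lastCases with
      | last =>
        refine ⟨⟨v, (mem v).2 (Or.inl rfl)⟩, hev, fun j hj => ?_⟩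
        induction j using Fin.lastCases with
        | last => exact absurd rfl hj
        | cast j =>
          exact ⟨⟨b j, (mem _).2 (Or.inr (hbS j))⟩, hvb j, by rw [heS (hbS j), hdb j]⟩
      | cast i =>
        refine ⟨⟨b i, (mem _).2 (Or.inr (hbS i))⟩, by rw [heS (hbS i), hdb i], fun j hj => ?_⟩
        induction j using Fin.lastCases with
        | last => exact ⟨⟨v, (mem v).2 (Or.inl rfl)⟩, (hvb i).symm, hev⟩
        | cast j =>
          obtain ⟨u, hu, hbu, hdu⟩ := hb i j fun h => hj (congrArg Fin.castSucc h)
          exact ⟨⟨u, (mem _).2 (Or.inr hu)⟩, hbu, by rw [heS hu, hdu]⟩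
    refine (hG (insert v S).toFinset ⟨fun x => e x.1, fun i => ?_, ?_, hbvert⟩).elim
    · obtain ⟨x, hx, -⟩ := hbvert i
      exact ⟨x, hx⟩
    · rintro ⟨x, hx⟩ ⟨y, hy⟩ hxy
      change G.Adj x y at hxy
      change e x ≠ e y
      rcases (mem x).1 hx with rfl | hxS <;> rcases (mem y).1 hy with rfl | hyS
      · exact absurd hxy (G.loopless.irrefl _)
      · rw [hev, heS hyS]
        exact (Fin.castSucc_lt_last _).ne'
      · rw [hev, heS hxS]
        exact (Fin.castSucc_lt_last _).ne
      · rw [heS hxS, heS hyS]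
        exact fun h => hd x hxS y hyS hxy (Fin.castSucc_injective _ h)

lemma IsFeasibleIn.hasBColoring {V : Type} [Fintype V] {G : SimpleGraph V} {t : ℕ}
    (hG : ∀ s : Finset V, ¬ HasBColoring (G.induce (↑s : Set V)) (t + 1))
    {s : Finset V} (h : IsFeasibleIn G s t) : HasBColoring G t := by
  classical
  obtain ⟨c, ⟨hsurj, -, hb⟩, hc⟩ := h
  have key (T : Finset V) : ∃ d : V → Fin t, (∀ x ∈ s, d x = c x) ∧
      ∀ x ∈ closedNbhdSet G ↑s ∪ ↑T, ∀ y ∈ closedNbhdSet G ↑s ∪ ↑T,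
        G.Adj x y → d x ≠ d y := by
    induction T using Finset.induction_on with
    | empty => exact ⟨c, fun _ _ => rfl, by simpa using fun x hx y hy => hc x y hx hy⟩
    | insert v T _ ih =>
      obtain ⟨d, hds, hd⟩ := ih
      rw [Finset.coe_insert, Set.union_insert]
      by_cases hv : v ∈ closedNbhdSet G ↑s ∪ ↑T
      · exact ⟨d, hds, by rwa [Set.insert_eq_of_mem hv]⟩
      · obtain ⟨d', hd', hproper⟩ := exists_proper_extension hG hd hv
        have hvs : v ∉ s := fun h => hv (Or.inl (Or.inl h))
        refine ⟨d', fun x hx => ?_, hproper⟩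
        rw [hd' x (fun h => hvs (h ▸ hx)) fun hvx => hv (Or.inl (Or.inr ⟨hvs, x, hx, hvx.symm⟩)),
          hds x hx]
  obtain ⟨d, hds, hd⟩ := key Finset.univ
  refine ⟨d, fun i => ?_, fun x y hxy => hd x (by simp) y (by simp) hxy, fun i => ?_⟩
  · obtain ⟨x, hx⟩ := hsurj i
    exact ⟨x.1, (hds x.1 x.2).trans hx⟩
  · obtain ⟨x, hx, hadj⟩ := hb i
    refine ⟨x.1, (hds x.1 x.2).trans hx, fun j hj => ?_⟩
    obtain ⟨u, hu, huj⟩ := hadj j hj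
    exact ⟨u.1, hu, (hds u.1 u.2).trans huj⟩

/-- with t = φ_r(G), if every induced minimal b-t-atom of G is feasible
in G, then φ(G) = φ_r(G). -/
theorem bChromatic_eq_bRelaxed_of_feasible {V : Type} [Fintype V] (G : SimpleGraph V)
    (h : ∀ s : Finset V, IsMinBAtom (G.induce (↑s : Set V)) (bRelaxed G) →
      IsFeasibleIn G s (bRelaxed G)) :
    bChromatic G = bRelaxed G := by
  refine le_antisymm (bChromatic_le_bRelaxed G) ?_
  rcases Nat.eq_zero_or_pos (bRelaxed G) with h0 | hpos
  · exact h0 ▸ Nat.zero_le _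
  obtain ⟨s₀, hs₀⟩ := exists_hasBColoring_bRelaxed hpos
  obtain ⟨r, hr⟩ := hs₀.exists_isBAtom
  obtain ⟨s, hs⟩ := exists_isMinBAtom_of_isBAtom (hr.of_iso (induceInduceIso G s₀ r))
  exact ((h s hs).hasBColoring fun _ hk => Nat.not_succ_le_self _ hk.le_bRelaxed).le_bChromatic
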